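/- Let 0 < δ ≤ 1. There is a constant C(δ) such that for every k ∈ ℤ² with k ≠ 0, Σ_{h ∈ ℤ², h ≠ 0, h ≠ k} ((h^⊥ · k)² / (‖h‖²·‖k‖²)) · (‖k−h‖^{1+δ} − ‖h‖^{1+δ})² / (‖h‖^{2δ}·‖k−h‖^{2+2δ}) ≤ C(δ)·(‖k‖² + ‖k‖^{2−2δ}). -/

import Mathlib

/-- The Euclidean norm of a lattice point `k ∈ ℤ²`. -/
noncomputable def znorm (k : ℤ × ℤ) : ℝ := Real.sqrt ((k.1 : ℝ) ^ 2 + (k.2 : ℝ) ^ 2)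

/-- `h^⊥ · k` where `h^⊥ = (−h₂, h₁)` and `·` is the standard dot product. -/
def perpDot (h k : ℤ × ℤ) : ℝ := ((-h.2 * k.1 + h.1 * k.2 : ℤ) : ℝ)

theorem znorm_eq_norm (k : ℤ × ℤ) : znorm k = ‖(⟨k.1, k.2⟩ : ℂ)‖ := by
  rw [znorm, Complex.norm_def, Complex.normSq_mk, sq, sq]

theorem znorm_nonneg (k : ℤ × ℤ) : 0 ≤ znorm k := Real.sqrt_nonneg _

theorem znorm_sq (k : ℤ × ℤ) : znorm k ^ 2 = (k.1 : ℝ) ^ 2 + (k.2 : ℝ) ^ 2 :=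
  Real.sq_sqrt (by positivity)

theorem norm_le_znorm (k : ℤ × ℤ) : ‖k‖ ≤ znorm k := by
  rw [Prod.norm_def, Int.norm_eq_abs, Int.norm_eq_abs]
  exact max_le (Real.abs_le_sqrt (by nlinarith [sq_nonneg (k.2 : ℝ)]))
    (Real.abs_le_sqrt (by nlinarith [sq_nonneg (k.1 : ℝ)]))

theorem znorm_pos {k : ℤ × ℤ} (hk : k ≠ 0) : 0 < znorm k :=
  (norm_pos_iff.2 hk).trans_le (norm_le_znorm k)

theorem abs_znorm_sub_sub_znorm_le (h k : ℤ × ℤ) : |znorm (k - h) - znorm h| ≤ znorm k := by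
  have e : (⟨k.1, k.2⟩ : ℂ) = ⟨(k - h).1, (k - h).2⟩ - -⟨h.1, h.2⟩ := by
    apply Complex.ext <;> simp
  rw [znorm_eq_norm, znorm_eq_norm h, znorm_eq_norm k, e,
    ← norm_neg (⟨h.1, h.2⟩ : ℂ)]
  exact abs_norm_sub_norm_le _ _

theorem perpDot_sq_le (h k : ℤ × ℤ) : perpDot h k ^ 2 ≤ znorm h ^ 2 * znorm k ^ 2 := by
  rw [znorm_sq, znorm_sq, perpDot]
  push_cast
  nlinarith [sq_nonneg ((h.1 : ℝ) * k.1 + h.2 * k.2)]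

theorem summable_znorm_rpow_neg {r : ℝ} (hr : 2 < r) :
    Summable fun h : ℤ × ℤ => znorm h ^ (-r) := by
  have hs := (finTwoArrowEquiv ℤ).symm.summable_iff.2
    (EisensteinSeries.summable_one_div_norm_rpow hr)
  refine hs.of_nonneg_of_le (fun h => Real.rpow_nonneg (znorm_nonneg h) _) fun h => ?_
  have e : ‖(finTwoArrowEquiv ℤ).symm h‖ = ‖h‖ := by
    simp [Prod.norm_def, EisensteinSeries.norm_eq_max_natAbs, Int.norm_eq_abs]
  simp only [Function.comp_apply, e]
  rcases eq_or_ne h 0 with rfl | hh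
  · simp [znorm]
  · exact Real.rpow_le_rpow_of_nonpos (norm_pos_iff.2 hh) (norm_le_znorm h) (by linarith)

theorem rpow_one_add_sub_le {a b δ : ℝ} (ha : 0 < a) (hab : a ≤ b) (hδ1 : δ ≤ 1) :
    b * b ^ δ - a * a ^ δ ≤ 2 * b ^ δ * (b - a) := by
  have hb : 0 < b := ha.trans_le hab
  have hq : 0 < b ^ δ := Real.rpow_pos_of_pos hb δ
  have ht : a / b ≤ (a / b) ^ δ := by
    simpa using Real.rpow_le_rpow_of_exponent_ge (div_pos ha hb) ((div_le_one hb).2 hab) hδ1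
  rw [Real.div_rpow ha.le hb.le, div_le_div_iff₀ hb hq] at ht
  have h1 : b * (2 * a * b ^ δ) ≤ b * (b * b ^ δ + a * a ^ δ) := by
    nlinarith [mul_le_mul_of_nonneg_left ht ha.le, mul_nonneg hq.le (sq_nonneg (b - a))]
  linarith [le_of_mul_le_mul_left h1 hb]

theorem rpow_difference_quotient_le {a b K δ : ℝ} (ha : 0 < a) (hb : 0 < b)
    (hK : |b - a| ≤ K) (hδ : 0 < δ) (hδ1 : δ ≤ 1) :
    (b ^ (1 + δ) - a ^ (1 + δ)) ^ 2 / (a ^ (2 * δ) * b ^ (2 + 2 * δ))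
      ≤ 4 * K ^ 2 * (a ^ (-(2 + 2 * δ)) + b ^ (-(2 + 2 * δ))) := by
  have hpow : ∀ x : ℝ, 0 < x → x ^ (2 + 2 * δ) = (x * x ^ δ) ^ 2 := fun x hx => by
    rw [← Real.rpow_one_add' hx.le (by linarith), ← Real.rpow_mul_natCast hx.le]
    congr 1
    push_cast
    ring
  have hp2 : a ^ (2 * δ) = (a ^ δ) ^ 2 := by
    rw [← Real.rpow_mul_natCast ha.le]
    congr 1
    push_cast
    ring
  rw [Real.rpow_neg ha.le, Real.rpow_neg hb.le, hpow a ha, hpow b hb, hp2,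
    Real.rpow_one_add' ha.le (by linarith), Real.rpow_one_add' hb.le (by linarith)]
  have hp : 0 < a ^ δ := Real.rpow_pos_of_pos ha δ
  have hq : 0 < b ^ δ := Real.rpow_pos_of_pos hb δ
  obtain ⟨hK1, hK2⟩ := abs_le.1 hK
  rcases le_total a b with hab | hab
  · have hd := rpow_one_add_sub_le ha hab hδ1
    have h0 : a * a ^ δ ≤ b * b ^ δ :=
      mul_le_mul hab (Real.rpow_le_rpow ha.le hab hδ.le) hp.le hb.le
    generalize a ^ δ = p at *
    generalize b ^ δ = q at *
    have hmain : (b * q - a * p) / (p * (b * q)) ≤ 2 * K / (a * p) := by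
      rw [div_le_div_iff₀ (by positivity) (by positivity)]
      have h1 : (b - a) * a ≤ K * b := mul_le_mul hK2 hab ha.le (by linarith)
      calc (b * q - a * p) * (a * p) ≤ 2 * q * (b - a) * (a * p) := by gcongr
        _ = 2 * q * p * ((b - a) * a) := by ring
        _ ≤ 2 * q * p * (K * b) := by gcongr
        _ = 2 * K * (p * (b * q)) := by ring
    calc (b * q - a * p) ^ 2 / (p ^ 2 * (b * q) ^ 2) = ((b * q - a * p) / (p * (b * q))) ^ 2 := by
          rw [div_pow, mul_pow p]
      _ ≤ (2 * K / (a * p)) ^ 2 :=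
          pow_le_pow_left₀ (div_nonneg (by linarith) (by positivity)) hmain 2
      _ = 4 * K ^ 2 * ((a * p) ^ 2)⁻¹ := by ring
      _ ≤ _ := by gcongr; exact le_add_of_nonneg_right (by positivity)
  · have hd := rpow_one_add_sub_le hb hab hδ1
    have h0 : b * b ^ δ ≤ a * a ^ δ :=
      mul_le_mul hab (Real.rpow_le_rpow hb.le hab hδ.le) hq.le ha.le
    generalize a ^ δ = p at *
    generalize b ^ δ = q at *
    have hmain : (a * p - b * q) / (p * (b * q)) ≤ 2 * K / (b * q) := by
      rw [div_le_div_iff₀ (by positivity) (by positivity)]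
      calc (a * p - b * q) * (b * q) ≤ 2 * p * (a - b) * (b * q) := by gcongr
        _ ≤ 2 * p * K * (b * q) := by gcongr; linarith
        _ = 2 * K * (p * (b * q)) := by ring
    calc (b * q - a * p) ^ 2 / (p ^ 2 * (b * q) ^ 2) = ((a * p - b * q) / (p * (b * q))) ^ 2 := by
          rw [div_pow, mul_pow p, sub_sq_comm]
      _ ≤ (2 * K / (b * q)) ^ 2 :=
          pow_le_pow_left₀ (div_nonneg (by linarith) (by positivity)) hmain 2
      _ = 4 * K ^ 2 * ((b * q) ^ 2)⁻¹ := by ring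
      _ ≤ _ := by gcongr; exact le_add_of_nonneg_left (by positivity)

/-- The frequency-by-frequency estimate in Appendix A: for `0 < δ ≤ 1` there is a constant
`C(δ)` such that for every `k ≠ 0`,
`Σ_{h≠0, h≠k} ((h^⊥·k)²/(‖h‖²‖k‖²))·(‖k−h‖^{1+δ} − ‖h‖^{1+δ})²/(‖h‖^{2δ}‖k−h‖^{2+2δ})
  ≤ C(δ)·(‖k‖² + ‖k‖^{2−2δ})` (the sum being finite). -/
theorem appendix_frequency_estimate (δ : ℝ) (hδ : 0 < δ) (hδ1 : δ ≤ 1) :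
    ∃ C : ℝ, 0 < C ∧ ∀ k : ℤ × ℤ, k ≠ 0 →
      Summable (fun h : {h : ℤ × ℤ // h ≠ 0 ∧ h ≠ k} =>
        (perpDot (h : ℤ × ℤ) k ^ 2 / (znorm (h : ℤ × ℤ) ^ 2 * znorm k ^ 2))
          * ((znorm (k - (h : ℤ × ℤ)) ^ (1 + δ) - znorm (h : ℤ × ℤ) ^ (1 + δ)) ^ 2
            / (znorm (h : ℤ × ℤ) ^ (2 * δ) * znorm (k - (h : ℤ × ℤ)) ^ (2 + 2 * δ)))) ∧
      (∑' h : {h : ℤ × ℤ // h ≠ 0 ∧ h ≠ k},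
        (perpDot (h : ℤ × ℤ) k ^ 2 / (znorm (h : ℤ × ℤ) ^ 2 * znorm k ^ 2))
          * ((znorm (k - (h : ℤ × ℤ)) ^ (1 + δ) - znorm (h : ℤ × ℤ) ^ (1 + δ)) ^ 2
            / (znorm (h : ℤ × ℤ) ^ (2 * δ) * znorm (k - (h : ℤ × ℤ)) ^ (2 + 2 * δ))))
        ≤ C * (znorm k ^ 2 + znorm k ^ (2 - 2 * δ)) := by
  set g : ℤ × ℤ → ℝ := fun h => znorm h ^ (-(2 + 2 * δ))
  have hgs : Summable g := summable_znorm_rpow_neg (by linarith)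
  have hg0 : ∀ h, 0 ≤ g h := fun h => Real.rpow_nonneg (znorm_nonneg h) _
  have hS : 0 ≤ ∑' h, g h := tsum_nonneg hg0
  refine ⟨8 * ∑' h, g h + 1, by linarith, fun k hk => ?_⟩
  have hgk : Summable fun h => g (k - h) := (Equiv.subLeft k).summable_iff.2 hgs
  have hgk_tsum : ∑' h, g (k - h) = ∑' h, g h := (Equiv.subLeft k).tsum_eq g
  have hF : Summable fun h => 4 * znorm k ^ 2 * (g h + g (k - h)) := (hgs.add hgk).mul_left _
  have hF0 : ∀ h, 0 ≤ 4 * znorm k ^ 2 * (g h + g (k - h)) := fun h =>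
    mul_nonneg (by positivity) (add_nonneg (hg0 _) (hg0 _))
  have hFsub := hF.subtype {h | h ≠ 0 ∧ h ≠ k}
  have hpos : ∀ h : {h : ℤ × ℤ // h ≠ 0 ∧ h ≠ k},
      0 ≤ (perpDot (h : ℤ × ℤ) k ^ 2 / (znorm (h : ℤ × ℤ) ^ 2 * znorm k ^ 2))
          * ((znorm (k - (h : ℤ × ℤ)) ^ (1 + δ) - znorm (h : ℤ × ℤ) ^ (1 + δ)) ^ 2
            / (znorm (h : ℤ × ℤ) ^ (2 * δ) * znorm (k - (h : ℤ × ℤ)) ^ (2 + 2 * δ))) := fun h => by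
    have := Real.rpow_nonneg (znorm_nonneg h) (2 * δ)
    have := Real.rpow_nonneg (znorm_nonneg (k - h)) (2 + 2 * δ)
    positivity
  have hle : ∀ h : {h : ℤ × ℤ // h ≠ 0 ∧ h ≠ k},
      (perpDot (h : ℤ × ℤ) k ^ 2 / (znorm (h : ℤ × ℤ) ^ 2 * znorm k ^ 2))
          * ((znorm (k - (h : ℤ × ℤ)) ^ (1 + δ) - znorm (h : ℤ × ℤ) ^ (1 + δ)) ^ 2
            / (znorm (h : ℤ × ℤ) ^ (2 * δ) * znorm (k - (h : ℤ × ℤ)) ^ (2 + 2 * δ)))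
        ≤ 4 * znorm k ^ 2 * (g h + g (k - h)) := fun h => by
    have ha := znorm_pos h.2.1
    have hb := znorm_pos (sub_ne_zero.2 h.2.2.symm)
    refine (mul_le_of_le_one_left (by positivity) ?_).trans
      (rpow_difference_quotient_le ha hb (abs_znorm_sub_sub_znorm_le h k) hδ hδ1)
    exact div_le_one_of_le₀ (perpDot_sq_le h k) (by positivity)
  have hsum := hFsub.of_nonneg_of_le hpos hle
  refine ⟨hsum, (hsum.tsum_le_tsum hle hFsub).trans ?_⟩
  refine (hF.tsum_subtype_le _ {h | h ≠ 0 ∧ h ≠ k} hF0).trans ?_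
  rw [tsum_mul_left, hgs.tsum_add hgk, hgk_tsum]
  have h1 : 0 ≤ znorm k ^ (2 - 2 * δ) := Real.rpow_nonneg (znorm_nonneg k) _
  nlinarith [mul_nonneg hS h1, sq_nonneg (znorm k)]
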